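/- Let G be a finite abelian p-group, l ≥ 0 an integer, and (g₁, p^l), (g₂, p^l) ∈ G ⊕ ℤ. There exists an automorphism Θ of G ⊕ ℤ with Θ((g₁, p^l)) = (g₂, p^l) if and only if (G ⊕ ℤ)/⟨(g₁, p^l)⟩ ≅ (G ⊕ ℤ)/⟨(g₂, p^l)⟩. -/

import Mathlib

/-- `ZMod n` is a self-injective ring for `n ≠ 0`. -/
theorem ZMod.baer_self (n : ℕ) [NeZero n] : Module.Baer (ZMod n) (ZMod n) := by
  intro I g
  have : IsPrincipalIdealRing (ZMod n) :=
    .of_surjective (Int.castRingHom (ZMod n)) ZMod.intCast_surjective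
  obtain ⟨k, rfl⟩ : ∃ k, I = Ideal.span {k} := (IsPrincipalIdealRing.principal I).principal
  have hk : k ∈ Ideal.span {k} := Ideal.mem_span_singleton_self k
  obtain ⟨q, hq⟩ : ∃ q, g ⟨k, hk⟩ = k * q := by
    obtain ⟨n', hn'⟩ := Nat.gcd_dvd_right k.val n
    have hd : 0 < Nat.gcd k.val n := Nat.gcd_pos_of_pos_right _ (NeZero.pos n)
    have hn'0 : 0 < n' := Nat.pos_of_ne_zero fun h ↦ NeZero.ne n (by rw [hn', h, mul_zero])
    have hz : (n' : ZMod n) * k = 0 := by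
      rw [← ZMod.natCast_zmod_val k, ← Nat.cast_mul, ZMod.natCast_eq_zero_iff]
      obtain ⟨r, hr⟩ := Nat.gcd_dvd_left k.val n
      refine ⟨r, ?_⟩
      calc n' * k.val = n' * (Nat.gcd k.val n * r) := by rw [← hr]
        _ = Nat.gcd k.val n * n' * r := by ring
        _ = n * r := by rw [← hn']
    have hgz : (n' : ZMod n) * g ⟨k, hk⟩ = 0 := by
      rw [← smul_eq_mul, ← map_smul]
      rw [show (n' : ZMod n) • (⟨k, hk⟩ : Ideal.span {k}) = 0 from Subtype.ext hz, map_zero]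
    rw [← ZMod.natCast_zmod_val (g ⟨k, hk⟩), ← Nat.cast_mul, ZMod.natCast_eq_zero_iff] at hgz
    have hdvd : Nat.gcd k.val n ∣ (g ⟨k, hk⟩).val := by
      refine Nat.dvd_of_mul_dvd_mul_right hn'0 ?_
      rwa [← hn', mul_comm]
    obtain ⟨q, hq⟩ := hdvd
    refine ⟨(Nat.gcdA k.val n : ZMod n) * q, ?_⟩
    have hb := congrArg (Int.cast : ℤ → ZMod n) (Nat.gcd_eq_gcd_ab k.val n)
    push_cast at hb
    rw [ZMod.natCast_self, zero_mul, add_zero, ZMod.natCast_zmod_val] at hb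
    rw [← ZMod.natCast_zmod_val (g ⟨k, hk⟩), hq, Nat.cast_mul, hb, mul_assoc]
  refine ⟨LinearMap.toSpanSingleton (ZMod n) (ZMod n) q, fun x hx ↦ ?_⟩
  obtain ⟨a, rfl⟩ := Ideal.mem_span_singleton'.1 hx
  have : (⟨a * k, hx⟩ : Ideal.span {k}) = a • ⟨k, hk⟩ := rfl
  rw [this, map_smul, hq, LinearMap.toSpanSingleton_apply, smul_eq_mul, smul_eq_mul, mul_assoc]

theorem exists_addMonoidHom_zmod_apply_eq {M : Type*} [AddCommGroup M] {n : ℕ} [NeZero n]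
    {v : M} {c : ZMod n}
    (h : ∀ m : ℕ, m • v ∈ (nsmulAddMonoidHom n : M →+ M).range → m • c = 0) :
    ∃ f : M →+ ZMod n, f v = c := by
  let H := (nsmulAddMonoidHom n : M →+ M).range
  let : Module (ZMod n) (M ⧸ H) := QuotientAddGroup.zmodModule fun x ↦ ⟨x, rfl⟩
  let s := LinearMap.toSpanSingleton (ZMod n) (M ⧸ H) (v : M ⧸ H)
  have hs : LinearMap.ker s ≤ LinearMap.ker (LinearMap.toSpanSingleton (ZMod n) (ZMod n) c) := by
    intro a ha
    rw [LinearMap.mem_ker, LinearMap.toSpanSingleton_apply] at ha ⊢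
    rw [← ZMod.natCast_zmod_val a, Nat.cast_smul_eq_nsmul] at ha ⊢
    exact h _ ((QuotientAddGroup.eq_zero_iff _).1 ha)
  obtain ⟨f, hf⟩ := (ZMod.baer_self n).extension_property ((LinearMap.ker s).liftQ s le_rfl)
    (LinearMap.ker_eq_bot.1 (Submodule.ker_liftQ_eq_bot _ _ _ le_rfl))
    ((LinearMap.ker s).liftQ _ hs)
  refine ⟨f.toAddMonoidHom.comp (QuotientAddGroup.mk' H), ?_⟩
  have h1 := congrArg (fun φ ↦ φ (Submodule.Quotient.mk 1)) hf
  simp only [LinearMap.comp_apply, Submodule.liftQ_apply, s, LinearMap.toSpanSingleton_apply,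
    one_smul] at h1
  exact h1

/-- Divisibility of the multiples of `v` by each `n`, compared with that of `w`, controls whether
some homomorphism to a finite group carries `v` to `w`. -/
theorem exists_addMonoidHom_apply_eq {M G : Type*} [AddCommGroup M] [AddCommGroup G] [Finite G]
    {v : M} {w : G} (h : ∀ n m : ℕ, n ≠ 0 → m • v ∈ (nsmulAddMonoidHom n : M →+ M).range →
      m • w ∈ (nsmulAddMonoidHom n : G →+ G).range) :
    ∃ f : M →+ G, f v = w := by
  classical
  obtain ⟨ι, _, n, hn, ⟨ψ⟩⟩ := AddCommGroup.equiv_directSum_zmod_of_finite' G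
  let ψ' : G ≃+ (∀ i, ZMod (n i)) := ψ.trans (DirectSum.addEquivProd _)
  have key (i : ι) : ∃ f : M →+ ZMod (n i), f v = ψ' w i := by
    have : NeZero (n i) := ⟨(zero_lt_one.trans (hn i)).ne'⟩
    refine exists_addMonoidHom_zmod_apply_eq fun m hm ↦ ?_
    obtain ⟨x, hx⟩ := h (n i) m (NeZero.ne _) hm
    have hx' := congrArg (fun y ↦ ψ' y i) hx
    simpa using hx'.symm
  choose f hf using key
  refine ⟨ψ'.symm.toAddMonoidHom.comp (AddMonoidHom.pi f), ?_⟩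
  have : AddMonoidHom.pi f v = ψ' w := funext hf
  simp [this]

theorem nsmul_mem_iff_relIndex_dvd {M : Type*} [AddCommGroup M] (H : AddSubgroup M)
    (v : M) (m : ℕ) : m • v ∈ H ↔ H.relIndex (AddSubgroup.zmultiples v) ∣ m := by
  have := AddSubgroup.relIndex_ker (QuotientAddGroup.mk' H) (K := AddSubgroup.zmultiples v)
  rw [QuotientAddGroup.ker_mk', AddMonoidHom.map_zmultiples, Nat.card_zmultiples] at this
  rw [this, addOrderOf_dvd_iff_nsmul_eq_zero, ← map_nsmul, QuotientAddGroup.mk'_apply,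
    QuotientAddGroup.eq_zero_iff]

theorem index_sup_eq_index_range_nsmul_quotient {M : Type*} [AddCommGroup M]
    (H : AddSubgroup M) (n : ℕ) :
    ((nsmulAddMonoidHom n : M →+ M).range ⊔ H).index =
      (nsmulAddMonoidHom n : (M ⧸ H) →+ (M ⧸ H)).range.index := by
  rw [← AddSubgroup.index_comap_of_surjective _ (QuotientAddGroup.mk'_surjective H)]
  congr 1
  ext x
  rw [AddSubgroup.mem_sup, AddSubgroup.mem_comap]
  constructor
  · rintro ⟨_, ⟨y, rfl⟩, z, hz, rfl⟩
    refine ⟨(y : M ⧸ H), ?_⟩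
    simp [(QuotientAddGroup.eq_zero_iff z).2 hz]
  · rintro ⟨y, hy⟩
    obtain ⟨y, rfl⟩ := QuotientAddGroup.mk'_surjective H y
    refine ⟨n • y, ⟨y, rfl⟩, x - n • y, ?_, by abel⟩
    rw [← QuotientAddGroup.eq_zero_iff]
    simpa [sub_eq_zero] using hy.symm

theorem index_range_nsmul_congr {A B : Type*} [AddCommGroup A] [AddCommGroup B] (e : A ≃+ B)
    (n : ℕ) : (nsmulAddMonoidHom n : A →+ A).range.index =
      (nsmulAddMonoidHom n : B →+ B).range.index := by
  rw [← AddSubgroup.index_map_equiv _ e]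
  congr 1
  ext x
  constructor
  · rintro ⟨_, ⟨y, rfl⟩, rfl⟩
    exact ⟨e y, by simp⟩
  · rintro ⟨y, rfl⟩
    exact ⟨n • e.symm y, ⟨e.symm y, rfl⟩, by simp⟩

theorem nsmul_mem_range_of_quotient_equiv {M : Type*} [AddCommGroup M] {v w : M} {n : ℕ}
    (hn : (nsmulAddMonoidHom n : M →+ M).range.index ≠ 0)
    (e : (M ⧸ AddSubgroup.zmultiples v) ≃+ (M ⧸ AddSubgroup.zmultiples w)) {m : ℕ}
    (h : m • v ∈ (nsmulAddMonoidHom n : M →+ M).range) :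
    m • w ∈ (nsmulAddMonoidHom n : M →+ M).range := by
  set N := (nsmulAddMonoidHom n : M →+ M).range with hN
  have hv := AddSubgroup.relIndex_mul_index (H := N) (K := N ⊔ AddSubgroup.zmultiples v) le_sup_left
  have hw := AddSubgroup.relIndex_mul_index (H := N) (K := N ⊔ AddSubgroup.zmultiples w) le_sup_left
  rw [AddSubgroup.relIndex_sup_left] at hv hw
  have hi : (N ⊔ AddSubgroup.zmultiples v).index = (N ⊔ AddSubgroup.zmultiples w).index := by
    rw [hN, index_sup_eq_index_range_nsmul_quotient, index_sup_eq_index_range_nsmul_quotient,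
      index_range_nsmul_congr e]
  have hr : N.relIndex (AddSubgroup.zmultiples v) = N.relIndex (AddSubgroup.zmultiples w) := by
    rw [← hw, ← hi] at hv
    refine Nat.eq_of_mul_eq_mul_right (Nat.pos_of_ne_zero fun h0 ↦ hn ?_) hv
    rw [← hw, ← hi, h0, mul_zero]
  rw [nsmul_mem_iff_relIndex_dvd] at h ⊢
  rwa [← hr]

theorem index_range_nsmul_prod_int_ne_zero {G : Type*} [AddCommGroup G] [Finite G] {n : ℕ}
    (hn : n ≠ 0) : (nsmulAddMonoidHom n : G × ℤ →+ G × ℤ).range.index ≠ 0 := by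
  have hle : (⊥ : AddSubgroup G).prod (AddSubgroup.zmultiples (n : ℤ)) ≤
      (nsmulAddMonoidHom n : G × ℤ →+ G × ℤ).range := by
    rintro ⟨x, y⟩ ⟨hx, hy⟩
    obtain ⟨k, rfl⟩ := AddSubgroup.mem_zmultiples_iff.1 hy
    exact ⟨(0, k), by simpa [mul_comm] using (AddSubgroup.mem_bot.1 hx).symm⟩
  refine ne_zero_of_dvd_ne_zero ?_ (AddSubgroup.index_dvd_of_le hle)
  rw [AddSubgroup.index_prod, AddSubgroup.index_bot, Int.index_zmultiples]
  simpa using ⟨Nat.card_pos.ne', hn⟩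

theorem exists_addMonoidHom_of_quotient_equiv {G : Type*} [AddCommGroup G] [Finite G] {d : ℤ}
    {g₁ g₂ : G} (e : ((G × ℤ) ⧸ AddSubgroup.zmultiples ((g₁, d) : G × ℤ)) ≃+
      ((G × ℤ) ⧸ AddSubgroup.zmultiples ((g₂, d) : G × ℤ))) :
    ∃ (y : G →+ G) (h : G), y g₁ + d • h = g₂ := by
  have key (n m : ℕ) (hn : n ≠ 0)
      (hm : m • ((g₁, d) : G × ℤ) ∈ (nsmulAddMonoidHom n : G × ℤ →+ G × ℤ).range) :
      m • g₂ ∈ (nsmulAddMonoidHom n : G →+ G).range := by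
    obtain ⟨x, hx⟩ := nsmul_mem_range_of_quotient_equiv (M := G × ℤ) (v := (g₁, d))
      (w := (g₂, d)) (n := n) (m := m) (index_range_nsmul_prod_int_ne_zero hn) e hm
    exact ⟨x.1, by simpa using congrArg Prod.fst hx⟩
  obtain ⟨f, hf⟩ := exists_addMonoidHom_apply_eq key
  refine ⟨f.comp (AddMonoidHom.inl G ℤ), f (0, 1), ?_⟩
  rw [← hf, ← map_zsmul, AddMonoidHom.comp_apply, ← map_add]
  simp

section Cancellation

universe u

/-- Homomorphisms with kernel `K` are injective homomorphisms from the quotient by `K`. -/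
noncomputable def kerEqEquivInjective {C B : Type u} [AddCommGroup C] [AddCommGroup B]
    (K : AddSubgroup C) :
    {f : C →+ B // f.ker = K} ≃ {f : (C ⧸ K) →+ B // Function.Injective f} where
  toFun f := ⟨QuotientAddGroup.lift K f.1 f.2.ge, by
    obtain ⟨f, rfl⟩ := f
    exact QuotientAddGroup.kerLift_injective f⟩
  invFun f := ⟨f.1.comp (QuotientAddGroup.mk' K), by
    rw [AddMonoidHom.ker_comp_of_injective _ _ f.2, QuotientAddGroup.ker_mk']⟩
  left_inv f := by ext; rfl
  right_inv f := by ext; rfl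

theorem card_addMonoidHom_eq_sum {C B : Type u} [AddCommGroup C] [AddCommGroup B] [Finite C]
    [Finite B] [Fintype (AddSubgroup C)] :
    Nat.card (C →+ B) =
      ∑ K : AddSubgroup C, Nat.card {f : (C ⧸ K) →+ B // Function.Injective f} := by
  have : Finite (C →+ B) := DFunLike.finite _
  rw [← Nat.card_congr (Equiv.sigmaFiberEquiv (fun f : C →+ B ↦ f.ker)), Nat.card_sigma]
  exact Finset.sum_congr rfl fun K _ ↦ Nat.card_congr (kerEqEquivInjective K)

theorem card_injective_eq_card_quotient_bot {C B : Type u} [AddCommGroup C] [AddCommGroup B] :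
    Nat.card {f : (C ⧸ (⊥ : AddSubgroup C)) →+ B // Function.Injective f} =
      Nat.card {f : C →+ B // Function.Injective f} := by
  rw [← Nat.card_congr (kerEqEquivInjective ⊥)]
  exact Nat.card_congr (Equiv.subtypeEquivRight fun f ↦ AddMonoidHom.ker_eq_bot_iff f)

theorem card_injective_congr {A B : Type u} [AddCommGroup A] [AddCommGroup B] [Finite A]
    [Finite B] (h : ∀ (C : Type u) [AddCommGroup C] [Finite C],
      Nat.card (C →+ A) = Nat.card (C →+ B))
    (C : Type u) [AddCommGroup C] [Finite C] :
    Nat.card {f : C →+ A // Function.Injective f} =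
      Nat.card {f : C →+ B // Function.Injective f} := by
  classical
  induction hc : Nat.card C using Nat.strong_induction_on generalizing C with
  | _ c ih =>
    have := Fintype.ofFinite (AddSubgroup C)
    have hC := h C
    rw [card_addMonoidHom_eq_sum, card_addMonoidHom_eq_sum,
      ← Finset.add_sum_erase _ _ (Finset.mem_univ ⊥),
      ← Finset.add_sum_erase Finset.univ
        (fun K : AddSubgroup C ↦ Nat.card {f : (C ⧸ K) →+ B // Function.Injective f})
        (Finset.mem_univ ⊥),
      card_injective_eq_card_quotient_bot, card_injective_eq_card_quotient_bot] at hC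
    refine Nat.add_right_cancel (hC.trans (congrArg _ (Finset.sum_congr rfl fun K hK ↦ ?_)).symm)
    refine ih _ ?_ _ rfl
    rw [← hc, AddSubgroup.card_eq_card_quotient_mul_card_addSubgroup K]
    exact lt_mul_of_one_lt_right Nat.card_pos
      ((AddSubgroup.one_lt_card_iff_ne_bot K).2 (Finset.ne_of_mem_erase hK))

/-- A finite abelian group is determined by the numbers of homomorphisms into it. -/
theorem nonempty_addEquiv_of_card_addMonoidHom_eq {A B : Type u} [AddCommGroup A]
    [AddCommGroup B] [Finite A] [Finite B] (h : ∀ (C : Type u) [AddCommGroup C] [Finite C],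
      Nat.card (C →+ A) = Nat.card (C →+ B)) : Nonempty (A ≃+ B) := by
  have exists_injective {X Y : Type u} [AddCommGroup X] [AddCommGroup Y] [Finite X] [Finite Y]
      (h : ∀ (C : Type u) [AddCommGroup C] [Finite C], Nat.card (C →+ X) = Nat.card (C →+ Y)) :
      ∃ f : X →+ Y, Function.Injective f := by
    have : Finite (X →+ X) := DFunLike.finite _
    have : Nonempty {f : X →+ X // Function.Injective f} :=
      ⟨⟨AddMonoidHom.id X, Function.injective_id⟩⟩
    have hpos := Nat.card_pos (α := {f : X →+ X // Function.Injective f})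
    rw [card_injective_congr h X] at hpos
    obtain ⟨f⟩ := (Nat.card_pos_iff.1 hpos).1
    exact ⟨f.1, f.2⟩
  obtain ⟨f, hf⟩ := exists_injective h
  obtain ⟨g, hg⟩ := exists_injective fun C _ _ ↦ (h C).symm
  have hcard := le_antisymm (Nat.card_le_card_of_injective f hf) (Nat.card_le_card_of_injective g hg)
  exact ⟨AddEquiv.ofBijective f ((Nat.bijective_iff_injective_and_card f).2 ⟨hf, hcard⟩)⟩

/-- Homomorphisms into a product are pairs of homomorphisms into the factors. -/
def AddMonoidHom.prodHomEquiv (C A B : Type*) [AddCommGroup C] [AddCommGroup A]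
    [AddCommGroup B] : (C →+ A) × (C →+ B) ≃ (C →+ A × B) where
  toFun f := f.1.prod f.2
  invFun f := ((AddMonoidHom.fst A B).comp f, (AddMonoidHom.snd A B).comp f)
  left_inv _ := rfl
  right_inv _ := rfl

/-- Finite abelian groups cancel from direct products. -/
theorem nonempty_addEquiv_of_prod {A B R S : Type u} [AddCommGroup A] [AddCommGroup B]
    [AddCommGroup R] [AddCommGroup S] [Finite A] [Finite B] [Finite R]
    (i : R ≃+ S) (e : R × A ≃+ S × B) : Nonempty (A ≃+ B) := by
  refine nonempty_addEquiv_of_card_addMonoidHom_eq fun C _ _ ↦ ?_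
  have : Finite (C →+ R) := DFunLike.finite _
  have h : Nat.card ((C →+ R) × (C →+ A)) = Nat.card ((C →+ R) × (C →+ B)) :=
    Nat.card_congr <| (AddMonoidHom.prodHomEquiv C R A).trans <|
      (AddEquiv.addMonoidHomCongrRightEquiv e).trans <|
      (AddMonoidHom.prodHomEquiv C S B).symm.trans <|
      (AddEquiv.addMonoidHomCongrRightEquiv i.symm).prodCongr (Equiv.refl _)
  rw [Nat.card_prod, Nat.card_prod] at h
  exact Nat.eq_of_mul_eq_mul_left Nat.card_pos h

end Cancellation

theorem exists_isIdempotentElem_pow {E : Type*} [Monoid E] [Finite E] (z : E) :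
    ∃ k : ℕ, k ≠ 0 ∧ IsIdempotentElem (z ^ k) := by
  obtain ⟨i, j, hij, h⟩ : ∃ i j : ℕ, i < j ∧ z ^ i = z ^ j := by
    obtain ⟨i, j, hne, h⟩ := Finite.exists_ne_map_eq_of_infinite (fun k : ℕ ↦ z ^ k)
    rcases hne.lt_or_gt with h' | h'
    exacts [⟨i, j, h', h⟩, ⟨j, i, h', h.symm⟩]
  obtain ⟨c, rfl⟩ := Nat.exists_eq_add_of_lt hij
  have step (t : ℕ) : z ^ (i + (c + 1) * t) = z ^ i := by
    induction t with
    | zero => simp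
    | succ t ih =>
      rw [show i + (c + 1) * (t + 1) = (i + (c + 1) * t) + (c + 1) by ring, pow_add, ih, ← pow_add,
        ← add_assoc, ← h]
  refine ⟨(c + 1) * (i + 1), by positivity, ?_⟩
  obtain ⟨r, hr⟩ : ∃ r, (c + 1) * (i + 1) = i + r := Nat.exists_eq_add_of_le (by nlinarith)
  rw [IsIdempotentElem, ← pow_add]
  nth_rewrite 1 [hr]
  rw [show i + r + (c + 1) * (i + 1) = i + (c + 1) * (i + 1) + r by ring, pow_add, step,
    ← pow_add, ← hr]

/-- An idempotent endomorphism splits an abelian group into its range and its kernel. -/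
def AddMonoidHom.rangeProdKerEquiv {G : Type*} [AddCommGroup G] (e : G →+ G)
    (he : ∀ g, e (e g) = e g) : e.range × e.ker ≃+ G where
  toFun x := x.1 + x.2
  invFun g := (⟨e g, g, rfl⟩, ⟨g - e g, by
    rw [AddMonoidHom.mem_ker, map_sub, sub_eq_zero, he]⟩)
  left_inv := by
    rintro ⟨⟨_, x, rfl⟩, ⟨y, hy⟩⟩
    have hy' : e y = 0 := hy
    ext <;> simp [he, hy']
  right_inv g := by simp
  map_add' x y := by simp only [Prod.fst_add, Prod.snd_add, AddSubgroup.coe_add]; abel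

/-- Fitting's idempotent for the composition of two endomorphisms of a finite group. -/
theorem exists_idempotent_comp {G : Type*} [AddCommGroup G] [Finite G] (x y : G →+ G) :
    ∃ e w s : G →+ G, (∀ g, e (e g) = e g) ∧ (∀ g, w (y g) = e g) ∧
      ∀ g, s (g - x (y g)) = g - e g := by
  have : Finite (AddMonoid.End G) := DFunLike.finite (G →+ G)
  let z : AddMonoid.End G := x.comp y
  obtain ⟨k, hk, he⟩ := exists_isIdempotentElem_pow z
  obtain ⟨k, rfl⟩ := Nat.exists_eq_succ_of_ne_zero hk
  exact ⟨z ^ (k + 1), (z ^ k : AddMonoid.End G).comp x, ∑ j ∈ Finset.range (k + 1), z ^ j,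
    DFunLike.congr_fun he, fun g ↦ (DFunLike.congr_fun (pow_succ z k) g).symm,
    DFunLike.congr_fun (geom_sum_mul_neg z (k + 1))⟩

/-- The stable range condition for the endomorphism ring of a finite abelian group. -/
theorem exists_addEquiv_eq_add_apply_sub {G : Type*} [AddCommGroup G] [Finite G]
    (x y : G →+ G) :
    ∃ (u : G ≃+ G) (s : G →+ G), ∀ g, u g = y g + s (g - x (y g)) := by
  obtain ⟨e, w, s, he, hwy, hs⟩ := exists_idempotent_comp x y
  let e' : G →+ G := y.comp (e.comp w)
  have he'_apply (g : G) : e' g = y (e (w g)) := rfl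
  have he' (g : G) : e' (e' g) = e' g := by simp only [he'_apply, hwy, he]
  let i : e.range ≃+ e'.range :=
    { toFun a := ⟨y a, by
        obtain ⟨_, a, rfl⟩ := a
        exact ⟨y (e a), by simp only [he'_apply, hwy, he]⟩⟩
      invFun b := ⟨e (w b), ⟨w b, rfl⟩⟩
      left_inv := by
        rintro ⟨_, a, rfl⟩
        ext
        simp only [hwy, he]
      right_inv := by
        rintro ⟨_, b, rfl⟩
        ext
        simp only [he'_apply, hwy, he]
      map_add' a b := by ext; simp }
  obtain ⟨θ⟩ := nonempty_addEquiv_of_prod i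
    ((e.rangeProdKerEquiv he).trans (e'.rangeProdKerEquiv he').symm)
  let π : G →+ e.ker := (AddMonoidHom.snd _ _).comp (e.rangeProdKerEquiv he).symm.toAddMonoidHom
  have hπ (g : G) : (π g : G) = g - e g := rfl
  have hπe (g : G) : π (g - e g) = π g := by ext; simp [hπ, he]
  let τ : G →+ G := e'.ker.subtype.comp (θ.toAddMonoidHom.comp π)
  have hτ (g : G) : τ g = θ (π g) := rfl
  have he'τ (g : G) : e' (τ g) = 0 := (θ (π g)).2
  let u : G →+ G := y.comp e + τ
  have hu (g : G) : u g = y (e g) + τ g := rfl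
  have hinj : Function.Injective u := by
    refine (injective_iff_map_eq_zero u).2 fun g hg ↦ ?_
    have h1 : y (e g) = 0 := by
      have := congrArg e' hg
      rwa [hu, map_add, he'τ, add_zero, map_zero, he'_apply, hwy, he, he] at this
    have h2 : e g = 0 := by rw [← he, ← hwy, h1, map_zero]
    have h3 : θ (π g) = 0 := by
      ext
      rw [← hτ, ← zero_add (τ g), ← h1, ← hu, hg, AddSubgroup.coe_zero]
    have h4 := congrArg Subtype.val (θ.map_eq_zero_iff.1 h3)
    rwa [hπ, h2, sub_zero] at h4
  refine ⟨AddEquiv.ofBijective u (Finite.injective_iff_bijective.1 hinj), (τ - y).comp s,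
    fun g ↦ ?_⟩
  rw [AddEquiv.ofBijective_apply, AddMonoidHom.comp_apply, AddMonoidHom.sub_apply, hs, hu, hτ, hτ,
    hπe, map_sub]
  abel

/-- The automorphism `(x, n) ↦ (u x + n • h, n)` of `G × ℤ`. -/
def AddEquiv.prodIntShear {G : Type*} [AddCommGroup G] (u : G ≃+ G) (h : G) :
    G × ℤ ≃+ G × ℤ where
  toFun a := (u a.1 + a.2 • h, a.2)
  invFun a := (u.symm (a.1 - a.2 • h), a.2)
  left_inv a := by simp
  right_inv a := by simp
  map_add' a b := by
    ext
    · simp only [Prod.fst_add, Prod.snd_add, map_add, add_smul]; abel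
    · rfl

/-- For a finite abelian `p`-group `G`, `l ≥ 0` and elements `(g₁, p^l), (g₂, p^l) ∈ G ⊕ ℤ`:
there is an automorphism of `G ⊕ ℤ` sending `(g₁, p^l)` to `(g₂, p^l)` iff the quotients
`(G ⊕ ℤ) ⧸ ⟨(gᵢ, p^l)⟩` are isomorphic. -/
theorem stmt5 {p : ℕ} (hp : p.Prime) {G : Type*} [AddCommGroup G] [Finite G]
    (hpG : ∀ x : G, ∃ j : ℕ, p ^ j • x = 0) (l : ℕ) (g₁ g₂ : G) :
    (∃ e : (G × ℤ) ≃+ (G × ℤ), e (g₁, (p : ℤ) ^ l) = (g₂, (p : ℤ) ^ l)) ↔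
      Nonempty (((G × ℤ) ⧸ AddSubgroup.zmultiples ((g₁, (p : ℤ) ^ l) : G × ℤ)) ≃+
        ((G × ℤ) ⧸ AddSubgroup.zmultiples ((g₂, (p : ℤ) ^ l) : G × ℤ))) := by
  constructor
  · rintro ⟨e, he⟩
    exact ⟨QuotientAddGroup.congr _ _ e (by rw [AddMonoidHom.map_zmultiples]; simp [he])⟩
  · rintro ⟨e⟩
    obtain ⟨y, h, hy⟩ := exists_addMonoidHom_of_quotient_equiv e
    obtain ⟨x, h', hx⟩ := exists_addMonoidHom_of_quotient_equiv e.symm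
    obtain ⟨u, s, hu⟩ := exists_addEquiv_eq_add_apply_sub x y
    refine ⟨u.prodIntShear (h - s (h' + x h)), Prod.ext ?_ rfl⟩
    change u g₁ + (p : ℤ) ^ l • (h - s (h' + x h)) = g₂
    have hd : g₁ - x (y g₁) = (p : ℤ) ^ l • (h' + x h) := by
      nth_rewrite 1 [← hx]
      rw [← hy, map_add, map_zsmul, smul_add]
      abel
    rw [hu, hd, map_zsmul, smul_sub, ← hy]
    abel
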